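/- arXiv:1011.1183 — 2 statements merged into one kernel-verified Lean document; each statement's English description precedes it below -/
import Mathlib

section
/- Let G be a group, let 1 → R → Q → S → 1 and 1 → R' → Q' → S' → 1 be central extensions of G-groups, and let ζ : R → R', η : Q → Q', θ : S → S' be G-equivariant homomorphisms making the two extensions commute. If the induced maps H^1(G,R) → H^1(G,R') and H^1(G,S) → H^1(G,S') are surjective and the induced map H^2(G,R) → H^2(G,R') is injective, then the induced map H^1(G,Q) → H^1(G,Q') is surjective. -/
/-- A right action of a group `G` on a group `Q` by group automorphisms,
written `q ↦ q^g` in the paper; here `act q g`. -/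
structure GAction (G : Type*) (Q : Type*) [Group G] [Group Q] where
  act : Q → G → Q
  act_one : ∀ q, act q 1 = q
  act_mul : ∀ q g h, act (act q g) h = act q (g * h)
  act_map_mul : ∀ g q q', act (q * q') g = act q g * act q' g

namespace GAction

variable {G Q : Type*} [Group G] [Group Q]

/-- `γ : G → Q` is a 1-cocycle: `γ(gh) = γ(g)^h · γ(h)`. -/
def IsCocycle (A : GAction G Q) (γ : G → Q) : Prop :=
  ∀ g h : G, γ (g * h) = A.act (γ g) h * γ h

/-- Two 1-cochains are cohomologous: `δ(g) = (q^g)⁻¹ · γ(g) · q` for some `q`. -/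
def Cohomologous (A : GAction G Q) (γ δ : G → Q) : Prop :=
  ∃ q : Q, ∀ g : G, δ g = (A.act q g)⁻¹ * γ g * q

/-- `τ : G × G → Q` is a 2-cocycle: `τ(g,h)^k · τ(gh,k) = τ(h,k) · τ(g,hk)`. -/
def IsTwoCocycle (A : GAction G Q) (τ : G → G → Q) : Prop :=
  ∀ g h k : G, A.act (τ g h) k * τ (g * h) k = τ h k * τ g (h * k)

/-- Two 2-cochains are cohomologous:
`τ'(g,h) = τ(g,h) · φ(g)^h · φ(h) · φ(gh)⁻¹` for some `φ : G → Q`. -/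
def TwoCohomologous (A : GAction G Q) (τ τ' : G → G → Q) : Prop :=
  ∃ φ : G → Q, ∀ g h : G, τ' g h = τ g h * A.act (φ g) h * φ h * (φ (g * h))⁻¹

/-- The restriction of a `G`-action to a subgroup `B ≤ G`. -/
def res (A : GAction G Q) (B : Subgroup G) : GAction B Q where
  act q b := A.act q (b : G)
  act_one q := by simpa using A.act_one q
  act_mul q b c := by simpa using A.act_mul q (b : G) (c : G)
  act_map_mul b q q' := A.act_map_mul (b : G) q q'

end GAction

/-- `1 → R →(ι) Q →(π) S → 1` is a central extension of `G`-groups. -/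
structure IsCentralExt {G R Q S : Type*} [Group G] [Group R] [Group Q] [Group S]
    (AR : GAction G R) (AQ : GAction G Q) (AS : GAction G S)
    (ι : R →* Q) (π : Q →* S) : Prop where
  ι_inj : Function.Injective ι
  π_surj : Function.Surjective π
  exact : ∀ q : Q, π q = 1 ↔ ∃ r : R, ι r = q
  ι_equiv : ∀ (r : R) (g : G), ι (AR.act r g) = AQ.act (ι r) g
  π_equiv : ∀ (q : Q) (g : G), π (AQ.act q g) = AS.act (π q) g
  central : ∀ (r : R) (q : Q), ι r * q = q * ι r

namespace GAction

variable {G Q : Type*} [Group G] [Group Q]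

theorem act_map_one (A : GAction G Q) (g : G) : A.act 1 g = 1 := by
  have h := A.act_map_mul g 1 1
  rw [mul_one] at h
  exact left_eq_mul.mp h

theorem act_map_inv (A : GAction G Q) (q : Q) (g : G) : A.act q⁻¹ g = (A.act q g)⁻¹ := by
  refine eq_inv_of_mul_eq_one_left ?_
  rw [← A.act_map_mul, inv_mul_cancel, A.act_map_one]

/-- The failure of a 1-cochain to be a 1-cocycle. -/
def coboundary (A : GAction G Q) (γ : G → Q) (g h : G) : Q :=
  A.act (γ g) h * γ h * (γ (g * h))⁻¹

theorem isCocycle_iff_coboundary_eq_one (A : GAction G Q) (γ : G → Q) :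
    A.IsCocycle γ ↔ ∀ g h, A.coboundary γ g h = 1 :=
  forall₂_congr fun _ _ => by rw [coboundary, mul_inv_eq_one, eq_comm]

theorem IsCocycle.conj {A : GAction G Q} {γ : G → Q} (hγ : A.IsCocycle γ) (q : Q) :
    A.IsCocycle fun g => A.act q g * γ g * q⁻¹ := by
  intro g h
  simp only [hγ g h, A.act_map_mul, A.act_map_inv, A.act_mul]
  group

theorem map_coboundary {Q' : Type*} [Group Q'] {A : GAction G Q} {A' : GAction G Q'}
    (f : Q →* Q') (hf : ∀ q g, f (A.act q g) = A'.act (f q) g) (γ : G → Q) (g h : G) :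
    f (A.coboundary γ g h) = A'.coboundary (fun x => f (γ x)) g h := by
  simp only [coboundary, map_mul, map_inv, hf]

theorem isTwoCocycle_one (A : GAction G Q) : A.IsTwoCocycle fun _ _ => 1 := by
  intro g h k
  simp only [A.act_map_one]

end GAction

namespace IsCentralExt

variable {G R Q S : Type*} [Group G] [Group R] [Group Q] [Group S]
  {AR : GAction G R} {AQ : GAction G Q} {AS : GAction G S} {ι : R →* Q} {π : Q →* S}

theorem map_ι (hE : IsCentralExt AR AQ AS ι π) (r : R) : π (ι r) = 1 :=
  (hE.exact _).mpr ⟨r, rfl⟩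

theorem exists_eq_mul_ι (hE : IsCentralExt AR AQ AS ι π) {γ δ : G → Q}
    (h : ∀ g, π (γ g) = π (δ g)) : ∃ ρ : G → R, ∀ g, δ g = γ g * ι (ρ g) := by
  have key (g : G) : ∃ r : R, ι r = (γ g)⁻¹ * δ g :=
    (hE.exact _).mp (by rw [map_mul, map_inv, h g, inv_mul_cancel])
  choose ρ hρ using key
  exact ⟨ρ, fun g => by rw [hρ g, mul_inv_cancel_left]⟩

theorem coboundary_mul_ι (hE : IsCentralExt AR AQ AS ι π) (γ : G → Q) (ρ : G → R) (g h : G) :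
    AQ.coboundary (fun x => γ x * ι (ρ x)) g h =
      AQ.coboundary γ g h * ι (AR.coboundary ρ g h) := by
  have c (r : R) (q : Q) : Commute (ι r) q := hE.central r q
  simp only [GAction.coboundary, AQ.act_map_mul, ← hE.ι_equiv, map_mul, map_inv, mul_inv_rev]
  calc AQ.act (γ g) h * ι (AR.act (ρ g) h) * (γ h * ι (ρ h)) * ((ι (ρ (g * h)))⁻¹ * (γ (g * h))⁻¹)
      = AQ.act (γ g) h * (ι (AR.act (ρ g) h) * γ h) *
          (ι (ρ h * (ρ (g * h))⁻¹) * (γ (g * h))⁻¹) := by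
        simp only [map_mul, map_inv, mul_assoc]
    _ = AQ.act (γ g) h * γ h * (ι (AR.act (ρ g) h) * (γ (g * h))⁻¹) *
          ι (ρ h * (ρ (g * h))⁻¹) := by
        rw [(c _ (γ h)).eq, (c (ρ h * _) _).eq]
        simp only [mul_assoc]
    _ = _ := by
        rw [(c _ (γ (g * h))⁻¹).eq]
        simp only [map_mul, map_inv, mul_assoc]

theorem isTwoCocycle_of_coboundary (hE : IsCentralExt AR AQ AS ι π) {γ : G → Q} {τ : G → G → R}
    (h : ∀ g h, ι (τ g h) = AQ.coboundary γ g h) : AR.IsTwoCocycle τ := by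
  intro x y z
  apply hE.ι_inj
  have e : ι (τ y z) * AQ.act (γ x) (y * z) = AQ.act (γ x) (y * z) * ι (τ y z) := hE.central _ _
  rw [map_mul, map_mul, hE.ι_equiv, h x (y * z), GAction.coboundary, ← mul_assoc, ← mul_assoc, e]
  simp only [h, GAction.coboundary, AQ.act_map_mul, AQ.act_map_inv, AQ.act_mul, mul_assoc,
    inv_mul_cancel_left]

end IsCentralExt

/-- five lemma for `H¹` along a morphism of extensions, surjectivity.
Given a morphism `(ζ, η, θ)` between central extensions `1 → R → Q → S → 1` and
`1 → R' → Q' → S' → 1` of `G`-groups, if the induced maps `H¹(G,R) → H¹(G,R')` and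
`H¹(G,S) → H¹(G,S')` are surjective and `H²(G,R) → H²(G,R')` is injective, then the
induced map `H¹(G,Q) → H¹(G,Q')` is surjective. -/
theorem five_lemma_h1_functorial_surjective
    {G R Q S R' Q' S' : Type*} [Group G] [Group R] [Group Q] [Group S]
    [Group R'] [Group Q'] [Group S']
    (AR : GAction G R) (AQ : GAction G Q) (AS : GAction G S)
    (AR' : GAction G R') (AQ' : GAction G Q') (AS' : GAction G S')
    (ι : R →* Q) (π : Q →* S) (ι' : R' →* Q') (π' : Q' →* S')
    (hCE : IsCentralExt AR AQ AS ι π) (hCE' : IsCentralExt AR' AQ' AS' ι' π')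
    (ζ : R →* R') (η : Q →* Q') (θ : S →* S')
    (hζ : ∀ (r : R) (g : G), ζ (AR.act r g) = AR'.act (ζ r) g)
    (hη : ∀ (q : Q) (g : G), η (AQ.act q g) = AQ'.act (η q) g)
    (hθ : ∀ (s : S) (g : G), θ (AS.act s g) = AS'.act (θ s) g)
    (hcomm1 : ∀ r : R, η (ι r) = ι' (ζ r))
    (hcomm2 : ∀ q : Q, π' (η q) = θ (π q))
    -- `H¹(G,R) → H¹(G,R')` surjective
    (h2 : ∀ β : G → R', AR'.IsCocycle β →
      ∃ γ : G → R, AR.IsCocycle γ ∧ AR'.Cohomologous (fun g => ζ (γ g)) β)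
    -- `H¹(G,S) → H¹(G,S')` surjective
    (h4 : ∀ β : G → S', AS'.IsCocycle β →
      ∃ γ : G → S, AS.IsCocycle γ ∧ AS'.Cohomologous (fun g => θ (γ g)) β)
    -- `H²(G,R) → H²(G,R')` injective
    (h5 : ∀ τ τ' : G → G → R, AR.IsTwoCocycle τ → AR.IsTwoCocycle τ' →
      AR'.TwoCohomologous (fun g h => ζ (τ g h)) (fun g h => ζ (τ' g h)) →
      AR.TwoCohomologous τ τ') :
    -- `H¹(G,Q) → H¹(G,Q')` surjective
    ∀ β : G → Q', AQ'.IsCocycle β →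
      ∃ γ : G → Q, AQ.IsCocycle γ ∧ AQ'.Cohomologous (fun g => η (γ g)) β := by
  intro β hβ
  obtain ⟨σ, hσ, s', hs'⟩ := h4 (fun g => π' (β g)) fun g h => by
    simp only [hβ g h, map_mul, hCE'.π_equiv]
  obtain ⟨q', rfl⟩ := hCE'.π_surj s'
  have hβ₁ := (AQ'.isCocycle_iff_coboundary_eq_one _).mp (hβ.conj q')
  set β₁ : G → Q' := fun g => AQ'.act q' g * β g * q'⁻¹ with hβ₁_def
  have hπβ₁ (g : G) : π' (β₁ g) = θ (σ g) := by
    simp only [hβ₁_def, map_mul, map_inv, hCE'.π_equiv, hs' g]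
    group
  choose a ha using fun g => hCE.π_surj (σ g)
  have hker (g h : G) : ∃ r : R, ι r = AQ.coboundary a g h := by
    refine (hCE.exact _).mp ?_
    rw [GAction.map_coboundary π hCE.π_equiv]
    simp only [ha]
    exact (AS.isCocycle_iff_coboundary_eq_one σ).mp hσ g h
  choose τ hτ using hker
  obtain ⟨ρ, hρ⟩ := hCE'.exists_eq_mul_ι (γ := fun g => η (a g)) (δ := β₁) fun g => by
    rw [hcomm2, ha, hπβ₁]
  obtain ⟨φ, hφ⟩ := h5 τ (fun _ _ => 1) (hCE.isTwoCocycle_of_coboundary hτ)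
    AR.isTwoCocycle_one ⟨ρ, fun g h => hCE'.ι_inj <| by
      have e := hβ₁ g h
      rw [funext hρ, hCE'.coboundary_mul_ι, ← GAction.map_coboundary η hη, ← hτ, hcomm1,
        ← map_mul] at e
      rw [map_one, map_one, ← e]
      simp only [GAction.coboundary, mul_assoc]⟩
  have hγ₀ (g h : G) : AQ.coboundary (fun x => a x * ι (φ x)) g h = 1 := by
    rw [hCE.coboundary_mul_ι, ← hτ, ← map_mul, ← map_one ι]
    refine congrArg ι (Eq.trans ?_ (hφ g h).symm)
    simp only [GAction.coboundary, mul_assoc]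
  set γ₀ : G → Q := fun x => a x * ι (φ x) with hγ₀_def
  obtain ⟨κ, hκ⟩ := hCE'.exists_eq_mul_ι (γ := fun g => η (γ₀ g)) (δ := β₁) fun g => by
    rw [hcomm2, hπβ₁, hγ₀_def, map_mul, hCE.map_ι, mul_one, ha]
  have hκ_cocycle : AR'.IsCocycle κ :=
    (AR'.isCocycle_iff_coboundary_eq_one κ).mpr fun g h => hCE'.ι_inj <| by
      have e := hβ₁ g h
      rwa [funext hκ, hCE'.coboundary_mul_ι, ← GAction.map_coboundary η hη, hγ₀, map_one,
        one_mul, ← map_one ι'] at e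
  obtain ⟨lam, hlam, r', hr'⟩ := h2 κ hκ_cocycle
  refine ⟨fun g => γ₀ g * ι (lam g), ?_, ι' r' * q', fun g => ?_⟩
  · refine (AQ.isCocycle_iff_coboundary_eq_one _).mpr fun g h => ?_
    rw [hCE.coboundary_mul_ι, hγ₀, (AR.isCocycle_iff_coboundary_eq_one lam).mp hlam, map_one,
      one_mul]
  · have e : β g = (AQ'.act q' g)⁻¹ * β₁ g * q' := by
      simp only [hβ₁_def]
      group
    have c : η (γ₀ g) * (ι' (AR'.act r' g))⁻¹ = (ι' (AR'.act r' g))⁻¹ * η (γ₀ g) := by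
      rw [← map_inv]
      exact (hCE'.central _ _).symm
    rw [e, hκ g, hr' g, AQ'.act_map_mul, ← hCE'.ι_equiv]
    simp only [map_mul, map_inv, hcomm1, mul_inv_rev, ← mul_assoc]
    rw [mul_assoc _ (η (γ₀ g)), c]
    simp only [mul_assoc]
end

section
/- Let G be a group, let 1 → R → Q → S → 1 and 1 → R' → Q' → S' → 1 be central extensions of G-groups, and let ζ : R → R', η : Q → Q', θ : S → S' be G-equivariant homomorphisms making the two extensions commute. Suppose the induced maps H^1(G,R) → H^1(G,R') and H^1(G,S) → H^1(G,S') are injective, and for every γ ∈ Z^1(G,S), writing γ' = θ ∘ γ, the map (S_γ)^G → (S'_{γ'})^G induced by θ on twisted fixed points is surjective. Then the induced map H^1(G,Q) → H^1(G,Q') is injective. -/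
namespace GAction

variable {G Q : Type*} [Group G] [Group Q] (A : GAction G Q)

theorem act_one_left (g : G) : A.act 1 g = 1 := by
  have h := A.act_map_mul g 1 1
  simpa using h

theorem act_inv (q : Q) (g : G) : A.act q⁻¹ g = (A.act q g)⁻¹ := by
  rw [eq_inv_iff_mul_eq_one, ← A.act_map_mul, inv_mul_cancel, A.act_one_left]

variable {A}

theorem IsCocycle.twist {γ : G → Q} (hγ : A.IsCocycle γ) (q : Q) :
    A.IsCocycle (fun g => (A.act q g)⁻¹ * γ g * q) := by
  intro g h
  simp only [hγ g h, A.act_map_mul, A.act_inv, A.act_mul]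
  group

theorem IsCocycle.map {Q' : Type*} [Group Q'] {A' : GAction G Q'} {f : Q →* Q'}
    (hf : ∀ (q : Q) (g : G), f (A.act q g) = A'.act (f q) g) {γ : G → Q}
    (hγ : A.IsCocycle γ) : A'.IsCocycle (fun g => f (γ g)) := by
  intro g h
  simp only [hγ g h, map_mul, hf]

theorem Cohomologous.of_twist {γ δ : G → Q} (q : Q)
    (h : A.Cohomologous (fun g => (A.act q g)⁻¹ * γ g * q) δ) : A.Cohomologous γ δ := by
  obtain ⟨p, hp⟩ := h
  refine ⟨q * p, fun g => ?_⟩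
  rw [hp g, A.act_map_mul]
  group

end GAction

/-- In a central extension, two cocycles with the same image in the quotient differ by a cocycle
with values in the kernel. -/
theorem IsCentralExt.exists_cocycle_mul {G R Q S : Type*} [Group G] [Group R] [Group Q] [Group S]
    {AR : GAction G R} {AQ : GAction G Q} {AS : GAction G S} {ι : R →* Q} {π : Q →* S}
    (hCE : IsCentralExt AR AQ AS ι π) {γ δ : G → Q} (hγ : AQ.IsCocycle γ) (hδ : AQ.IsCocycle δ)
    (h : ∀ g, π (γ g) = π (δ g)) :
    ∃ ρ : G → R, AR.IsCocycle ρ ∧ ∀ g, δ g = ι (ρ g) * γ g := by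
  have hex : ∀ g, ∃ r : R, ι r = δ g * (γ g)⁻¹ := fun g =>
    (hCE.exact _).1 (by rw [map_mul, map_inv, h, mul_inv_cancel])
  choose ρ hρ using hex
  have hδρ : ∀ g, δ g = ι (ρ g) * γ g := fun g => by rw [hρ, inv_mul_cancel_right]
  refine ⟨ρ, fun g k => hCE.ι_inj (mul_right_cancel (b := γ (g * k)) ?_), hδρ⟩
  rw [← hδρ, hδ g k, hγ g k, hδρ g, hδρ k, AQ.act_map_mul, map_mul, hCE.ι_equiv]
  simp only [mul_assoc]
  rw [← mul_assoc (AQ.act (γ g) k), ← hCE.central, mul_assoc]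

/-- The case of the five lemma in which the two cocycles agree in the quotient and their images
are cohomologous through an element of the kernel. -/
theorem IsCentralExt.cohomologous_of_map_eq {G R Q S R' Q' S' : Type*} [Group G] [Group R]
    [Group Q] [Group S] [Group R'] [Group Q'] [Group S']
    {AR : GAction G R} {AQ : GAction G Q} {AS : GAction G S}
    {AR' : GAction G R'} {AQ' : GAction G Q'} {AS' : GAction G S'}
    {ι : R →* Q} {π : Q →* S} {ι' : R' →* Q'} {π' : Q' →* S'}
    (hCE : IsCentralExt AR AQ AS ι π) (hCE' : IsCentralExt AR' AQ' AS' ι' π')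
    {ζ : R →* R'} {η : Q →* Q'} (hcomm : ∀ r : R, η (ι r) = ι' (ζ r))
    (hinj : ∀ γ δ : G → R, AR.IsCocycle γ → AR.IsCocycle δ →
      AR'.Cohomologous (fun g => ζ (γ g)) (fun g => ζ (δ g)) → AR.Cohomologous γ δ)
    {γ δ : G → Q} (hγ : AQ.IsCocycle γ) (hδ : AQ.IsCocycle δ)
    (hπ : ∀ g, π (γ g) = π (δ g)) (r' : R')
    (hr' : ∀ g, η (δ g) = (AQ'.act (ι' r') g)⁻¹ * η (γ g) * ι' r') :
    AQ.Cohomologous γ δ := by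
  obtain ⟨ρ, hρ, hδρ⟩ := hCE.exists_cocycle_mul hγ hδ hπ
  have h1 : AR.IsCocycle (fun _ => 1) := fun g k => by rw [AR.act_one_left, mul_one]
  obtain ⟨r, hr⟩ := hinj _ ρ h1 hρ ⟨r', fun g => hCE'.ι_inj (mul_right_cancel (b := η (γ g)) (by
    rw [← hcomm, ← map_mul, ← hδρ, hr', ← hCE'.ι_equiv, mul_assoc, ← hCE'.central]
    simp [mul_assoc]))⟩
  refine ⟨ι r, fun g => ?_⟩
  rw [hδρ, hr, ← hCE.ι_equiv, mul_assoc _ (γ g), ← hCE.central]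
  simp [mul_assoc]

/-- five lemma for `H¹` along a morphism of extensions, injectivity.
Given a morphism `(ζ, η, θ)` between central extensions `1 → R → Q → S → 1` and
`1 → R' → Q' → S' → 1` of `G`-groups, if the induced maps `H¹(G,R) → H¹(G,R')` and
`H¹(G,S) → H¹(G,S')` are injective, and for every `γ ∈ Z¹(G,S)` (with `γ' = θ ∘ γ`)
the map `(S_γ)^G → (S'_{γ'})^G` induced by `θ` on twisted fixed points is surjective,
then the induced map `H¹(G,Q) → H¹(G,Q')` is injective. -/
theorem five_lemma_h1_functorial_injective
    {G R Q S R' Q' S' : Type*} [Group G] [Group R] [Group Q] [Group S]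
    [Group R'] [Group Q'] [Group S']
    (AR : GAction G R) (AQ : GAction G Q) (AS : GAction G S)
    (AR' : GAction G R') (AQ' : GAction G Q') (AS' : GAction G S')
    (ι : R →* Q) (π : Q →* S) (ι' : R' →* Q') (π' : Q' →* S')
    (hCE : IsCentralExt AR AQ AS ι π) (hCE' : IsCentralExt AR' AQ' AS' ι' π')
    (ζ : R →* R') (η : Q →* Q') (θ : S →* S')
    (hζ : ∀ (r : R) (g : G), ζ (AR.act r g) = AR'.act (ζ r) g)
    (hη : ∀ (q : Q) (g : G), η (AQ.act q g) = AQ'.act (η q) g)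
    (hθ : ∀ (s : S) (g : G), θ (AS.act s g) = AS'.act (θ s) g)
    (hcomm1 : ∀ r : R, η (ι r) = ι' (ζ r))
    (hcomm2 : ∀ q : Q, π' (η q) = θ (π q))
    -- `H¹(G,R) → H¹(G,R')` injective
    (h2 : ∀ γ δ : G → R, AR.IsCocycle γ → AR.IsCocycle δ →
      AR'.Cohomologous (fun g => ζ (γ g)) (fun g => ζ (δ g)) → AR.Cohomologous γ δ)
    -- `H¹(G,S) → H¹(G,S')` injective
    (h4 : ∀ γ δ : G → S, AS.IsCocycle γ → AS.IsCocycle δ →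
      AS'.Cohomologous (fun g => θ (γ g)) (fun g => θ (δ g)) → AS.Cohomologous γ δ)
    -- for every `γ ∈ Z¹(G,S)`, the map `(S_γ)^G → (S'_{θ∘γ})^G` induced by `θ` is onto
    (hfix : ∀ γ : G → S, AS.IsCocycle γ → ∀ s' : S',
      (∀ g : G, (θ (γ g))⁻¹ * AS'.act s' g * θ (γ g) = s') →
      ∃ s : S, (∀ g : G, (γ g)⁻¹ * AS.act s g * γ g = s) ∧ θ s = s') :
    -- `H¹(G,Q) → H¹(G,Q')` injective
    ∀ γ δ : G → Q, AQ.IsCocycle γ → AQ.IsCocycle δ →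
      AQ'.Cohomologous (fun g => η (γ g)) (fun g => η (δ g)) → AQ.Cohomologous γ δ := by
  intro γ δ hγ hδ ⟨q', hq'⟩
  obtain ⟨s, hs⟩ := h4 _ _ (hγ.map hCE.π_equiv) (hδ.map hCE.π_equiv)
    ⟨π' q', fun g => by simp only [← hcomm2, hq', map_mul, map_inv, hCE'.π_equiv]⟩
  obtain ⟨q, rfl⟩ := hCE.π_surj s
  apply GAction.Cohomologous.of_twist q
  set γ₁ : G → Q := fun g => (AQ.act q g)⁻¹ * γ g * q with hγ₁_def
  have hγ₁ : AQ.IsCocycle γ₁ := hγ.twist q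
  have hπ₁ : ∀ g, π (γ₁ g) = π (δ g) := fun g => by
    simp only [hγ₁_def, hs, map_mul, map_inv, hCE.π_equiv]
  set q₁' : Q' := (η q)⁻¹ * q' with hq₁'_def
  have hη₁ : ∀ g, η (δ g) = (AQ'.act q₁' g)⁻¹ * η (γ₁ g) * q₁' := fun g => by
    simp only [hγ₁_def, hq₁'_def, hq', map_mul, map_inv, hη, AQ'.act_map_mul, AQ'.act_inv]
    group
  obtain ⟨t, ht, htq⟩ := hfix _ (hδ.map hCE.π_equiv) (π' q₁') fun g => by
    have h := congrArg π' (hη₁ g)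
    simp only [map_mul, map_inv, hcomm2, hCE'.π_equiv, hπ₁] at h
    rw [mul_assoc, eq_inv_mul_iff_mul_eq] at h
    rw [mul_assoc, inv_mul_eq_iff_eq_mul, h]
  obtain ⟨p, rfl⟩ := hCE.π_surj t
  obtain ⟨r', hr'⟩ := (hCE'.exact ((η p)⁻¹ * q₁')).1 (by
    rw [map_mul, map_inv, hcomm2, htq, inv_mul_cancel])
  apply GAction.Cohomologous.of_twist p
  refine hCE.cohomologous_of_map_eq hCE' hcomm1 h2 (hγ₁.twist p) hδ (fun g => ?_) r' fun g => ?_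
  · have h := ht g
    rw [mul_assoc, inv_mul_eq_iff_eq_mul] at h
    rw [map_mul, map_mul, map_inv, hCE.π_equiv, hπ₁, mul_assoc, ← h, inv_mul_cancel_left]
  · simp only [hr', hη₁, map_mul, map_inv, hη, AQ'.act_map_mul, AQ'.act_inv]
    group
end
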